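/- Let k ≥ 4 and let a, b be integers with 2 ≤ a ≤ k−1 and 2 ≤ b ≤ k−1. Then for every n > k, |Π_n(β_{k,a})| = |Π_n(β_{k,b})|; that is, β_{k,a} and β_{k,b} are Wilf-equivalent. -/

import Mathlib

open Finset

/-- The ground set `[n] = {1, …, n}`. -/
def Idx (n : ℕ) : Finset ℕ := Finset.Icc 1 n

/-- `i` and `j` lie in the same block of the set partition `π`. -/
def SameBlock {n : ℕ} (π : Finpartition (Idx n)) (i j : ℕ) : Prop :=
  ∃ B ∈ π.parts, i ∈ B ∧ j ∈ B

/-- Klazar containment: `σ ⊢ [n]` contains `τ ⊢ [k]` if there is a strictly increasing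
map `f : [k] → [n]` such that `i, j` are in the same block of `τ` iff `f i, f j` are in
the same block of `σ`. -/
def Contains {k n : ℕ} (τ : Finpartition (Idx k)) (σ : Finpartition (Idx n)) : Prop :=
  ∃ f : ℕ → ℕ, StrictMonoOn f (Idx k) ∧ (∀ i ∈ Idx k, f i ∈ Idx n) ∧
    ∀ i ∈ Idx k, ∀ j ∈ Idx k, (SameBlock τ i j ↔ SameBlock σ (f i) (f j))

/-- `σ` avoids the pattern `τ`. -/
def Avoids {k n : ℕ} (σ : Finpartition (Idx n)) (τ : Finpartition (Idx k)) : Prop :=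
  ¬ Contains τ σ

/-- `|Π_n(τ)|`, the number of set partitions of `[n]` avoiding `τ`. -/
noncomputable def avoidCount (n : ℕ) {k : ℕ} (τ : Finpartition (Idx k)) : ℕ :=
  Nat.card {σ : Finpartition (Idx n) // Avoids σ τ}


/-- `l` has no subword `cᵖ x c^q` with `x ≠ c`. -/
def WordAvoids {α : Type*} (p q : ℕ) (l : List α) : Prop :=
  ∀ c x : α, x ≠ c → ¬ (List.replicate p c ++ x :: List.replicate q c).Sublist l

/-- Repeat the occurrence of `c` that is preceded by exactly `i` others. -/
def dupOcc {α : Type*} [DecidableEq α] (c : α) : ℕ → List α → List α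
  | _, [] => []
  | 0, x :: l => if x = c then c :: c :: l else x :: dupOcc c 0 l
  | i + 1, x :: l => if x = c then c :: dupOcc c i l else x :: dupOcc c (i + 1) l

section Words

variable {α : Type*} [DecidableEq α]

theorem replicate_append_cons_replicate_sublist_iff {p q : ℕ} {c x : α} {l : List α} :
    (List.replicate p c ++ x :: List.replicate q c).Sublist l ↔
      ∃ u v, l = u ++ x :: v ∧ p ≤ u.count c ∧ q ≤ v.count c := by
  constructor
  · rw [List.append_sublist_iff]
    rintro ⟨l₁, l₂, rfl, h₁, h₂⟩
    rw [List.cons_sublist_iff] at h₂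
    obtain ⟨r₁, r₂, rfl, hx, h₂⟩ := h₂
    obtain ⟨s, t, rfl⟩ := List.append_of_mem hx
    refine ⟨l₁ ++ s, t ++ r₂, by simp, ?_, ?_⟩
    · have := List.replicate_sublist_iff.1 h₁
      simp only [List.count_append]; omega
    · have := List.replicate_sublist_iff.1 h₂
      simp only [List.count_append]; omega
  · rintro ⟨u, v, rfl, hu, hv⟩
    exact (List.replicate_sublist_iff.2 hu).append
      ((List.replicate_sublist_iff.2 hv).cons_cons x)

theorem exists_eq_append_cons_of_lt_count {c : α} {i : ℕ} {l : List α} (h : i < l.count c) :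
    ∃ u v, l = u ++ c :: v ∧ u.count c = i := by
  induction l generalizing i with
  | nil => simp at h
  | cons x l ih =>
    by_cases hx : x = c
    · subst hx
      cases i with
      | zero => exact ⟨[], l, rfl, rfl⟩
      | succ i =>
        obtain ⟨u, v, rfl, hu⟩ := ih (i := i) (by simpa using h)
        exact ⟨x :: u, v, rfl, by simpa using hu⟩
    · obtain ⟨u, v, rfl, hu⟩ := ih (i := i) (by simpa [List.count_cons, hx] using h)
      exact ⟨x :: u, v, rfl, by simpa [List.count_cons, hx] using hu⟩

theorem dupOcc_append_cons (c : α) (u v : List α) :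
    dupOcc c (u.count c) (u ++ c :: v) = u ++ c :: c :: v := by
  induction u with
  | nil => simp [dupOcc]
  | cons x u ih =>
    by_cases hx : x = c
    · subst hx
      simp [dupOcc, ih]
    · rw [List.count_cons_of_ne (by simpa using hx)]
      generalize u.count c = i at ih
      cases i <;> simp [dupOcc, hx, ih]

theorem dupOcc_injective (c : α) (i : ℕ) : Function.Injective (dupOcc c i) := by
  intro l
  induction l generalizing i with
  | nil =>
    rintro (_ | ⟨y, l'⟩) h
    · rfl
    · cases i <;> simp only [dupOcc] at h <;> split at h <;> simp at h
  | cons x l ih =>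
    rintro (_ | ⟨y, l'⟩) h
    · cases i <;> simp only [dupOcc] at h <;> split at h <;> simp at h
    · cases i with
      | zero =>
        simp only [dupOcc] at h
        split at h <;> split at h <;> simp_all
        exact ih 0 h.2
      | succ i =>
        simp only [dupOcc] at h
        split at h <;> split at h <;> simp_all
        · exact ih i h
        · exact ih (i + 1) h.2

theorem wordAvoids_append_cons_cons_iff {p q : ℕ} {c : α} {u v : List α}
    (hu : u.count c + 1 = p) :
    WordAvoids p q (u ++ c :: c :: v) ↔ WordAvoids p q (u ++ c :: v) := by
  refine ⟨fun h d x hx hs ↦ h d x hx (hs.trans ?_), fun h d x hx hs ↦ h d x hx ?_⟩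
  · simp
  rw [replicate_append_cons_replicate_sublist_iff] at hs ⊢
  obtain ⟨u', v', he, hu', hv'⟩ := hs
  rw [List.append_eq_append_iff] at he
  rcases he with ⟨w, rfl, he⟩ | ⟨w, rfl, he⟩
  · rcases w with _ | ⟨y, w⟩
    · obtain ⟨rfl, rfl⟩ : c = x ∧ c :: v = v' := by simpa using he
      refine ⟨u, v, by simp, by simpa using hu', ?_⟩
      rwa [List.count_cons_of_ne (by simpa using hx)] at hv'
    · obtain ⟨rfl, hw⟩ : c = y ∧ c :: v = w ++ x :: v' := by simpa using he
      refine ⟨u ++ w, v', by rw [hw, List.append_assoc], ?_, hv'⟩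
      by_cases hd : c = d
      · subst hd
        rcases w with _ | ⟨z, w⟩
        · simp_all
        · simp_all
          omega
      · simpa [List.count_cons, hd] using hu'
  · rcases w with _ | ⟨y, w⟩
    · obtain ⟨rfl, rfl⟩ : x = c ∧ v' = c :: v := by simpa using he
      refine ⟨u', v, by simp, by simpa using hu', ?_⟩
      rwa [List.count_cons_of_ne (by simpa using hx)] at hv'
    · obtain ⟨rfl, rfl⟩ : x = y ∧ v' = w ++ c :: c :: v := by simpa using he
      have hd : c ≠ d := by
        rintro rfl
        simp at hu
        omega
      refine ⟨u', w ++ c :: v, by simp, hu', ?_⟩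
      simpa [List.count_cons, hd] using hv'

/-- The words avoiding `cᵖ x c^q` in which every letter `c` occurs `s c` times. -/
abbrev AvoidingWord (p q : ℕ) (s : α → ℕ) : Type _ :=
  {l : {l : List α // WordAvoids p q l} // (fun c ↦ l.1.count c) = s}

theorem nonempty_avoidingWord_equiv_update {p q : ℕ} (hp : 1 ≤ p) (hq : 1 ≤ q) {s : α → ℕ} {c : α}
    (hc : p + q ≤ s c) :
    Nonempty (AvoidingWord p q (Function.update s c (s c - 1)) ≃ AvoidingWord p q s) := by
  obtain ⟨i, rfl⟩ : ∃ i, p = i + 1 := ⟨p - 1, by omega⟩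
  have key : ∀ l : AvoidingWord (i + 1) q (Function.update s c (s c - 1)),
      ∃ u v, l.1.1 = u ++ c :: v ∧ u.count c = i := by
    intro l
    refine exists_eq_append_cons_of_lt_count ?_
    have := congrFun l.2 c
    simp at this
    omega
  have mem : ∀ l : AvoidingWord (i + 1) q (Function.update s c (s c - 1)),
      WordAvoids (i + 1) q (dupOcc c i l.1.1) ∧ (fun d ↦ (dupOcc c i l.1.1).count d) = s := by
    intro l
    obtain ⟨u, v, he, hu⟩ := key l
    have h₁ := l.1.2
    have h₂ := l.2
    simp only [he] at h₁ h₂ ⊢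
    have h₃ := dupOcc_append_cons c u v
    rw [hu] at h₃
    rw [h₃]
    refine ⟨(wordAvoids_append_cons_cons_iff (by omega)).2 h₁, ?_⟩
    funext d
    have := congrFun h₂ d
    by_cases hd : c = d
    · subst hd
      simp at this ⊢
      omega
    · simpa [List.count_cons, hd, Function.update_of_ne (Ne.symm hd)] using this
  refine ⟨Equiv.ofBijective (fun l ↦ ⟨⟨dupOcc c i l.1.1, (mem l).1⟩, (mem l).2⟩) ⟨?_, ?_⟩⟩
  · intro l l' h
    have h' : dupOcc c i l.1.1 = dupOcc c i l'.1.1 := congrArg (fun z ↦ z.1.1) h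
    exact Subtype.ext (Subtype.ext (dupOcc_injective c i h'))
  · rintro ⟨⟨l, hl⟩, hs⟩
    have hcount : l.count c = s c := congrFun hs c
    obtain ⟨u, v, rfl, hu⟩ := exists_eq_append_cons_of_lt_count (show i < l.count c by omega)
    obtain ⟨v, rfl⟩ : ∃ w, v = c :: w := by
      rcases v with _ | ⟨y, v⟩
      · simp at hcount
        omega
      · by_cases hy : y = c
        · exact ⟨v, by rw [hy]⟩
        · refine (hl c y hy (replicate_append_cons_replicate_sublist_iff.2
            ⟨u ++ [c], v, by simp, by simp [hu], ?_⟩)).elim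
          simp [hy] at hcount
          omega
    refine ⟨⟨⟨u ++ c :: v, (wordAvoids_append_cons_cons_iff (by omega)).1 hl⟩, ?_⟩, ?_⟩
    · funext d
      have := congrFun hs d
      by_cases hd : c = d
      · subst hd
        simp at this ⊢
        omega
      · simpa [List.count_cons, hd, Function.update_of_ne (Ne.symm hd)] using this
    · refine Subtype.ext (Subtype.ext ?_)
      have := dupOcc_append_cons c u v
      rwa [hu] at this

theorem wordAvoids_of_count_lt {p q : ℕ} {l : List α} (h : ∀ c, l.count c < p + q) :
    WordAvoids p q l := by
  intro c x hx hs
  obtain ⟨u, v, rfl, hu, hv⟩ := replicate_append_cons_replicate_sublist_iff.1 hs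
  have := h c
  simp [List.count_cons] at this
  omega

theorem nonempty_avoidingWord_equiv [Fintype α] {p q p' q' : ℕ} (hp : 1 ≤ p) (hq : 1 ≤ q)
    (hp' : 1 ≤ p') (hq' : 1 ≤ q') (h : p + q = p' + q') (s : α → ℕ) :
    Nonempty (AvoidingWord p q s ≃ AvoidingWord p' q' s) := by
  induction hN : ∑ c, s c using Nat.strong_induction_on generalizing s with
  | _ N ih =>
    by_cases hs : ∃ c, p + q ≤ s c
    · obtain ⟨c, hc⟩ := hs
      have hlt : ∑ d, Function.update s c (s c - 1) d < N := by
        rw [← hN]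
        refine Finset.sum_lt_sum (fun d _ ↦ ?_) ⟨c, Finset.mem_univ c, ?_⟩
        · by_cases hd : d = c
          · subst hd; simp
          · simp [hd]
        · simp
          omega
      obtain ⟨e⟩ := ih _ hlt _ rfl
      obtain ⟨e₁⟩ := nonempty_avoidingWord_equiv_update hp hq hc
      obtain ⟨e₂⟩ := nonempty_avoidingWord_equiv_update hp' hq' (s := s) (c := c) (by omega)
      exact ⟨e₁.symm.trans (e.trans e₂)⟩
    · push Not at hs
      have hall : ∀ l : List α, (fun c ↦ l.count c) = s →
          WordAvoids p q l ∧ WordAvoids p' q' l := by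
        rintro l rfl
        exact ⟨wordAvoids_of_count_lt hs, wordAvoids_of_count_lt (by simpa [← h] using hs)⟩
      exact ⟨⟨fun l ↦ ⟨⟨l.1.1, (hall _ l.2).2⟩, l.2⟩, fun l ↦ ⟨⟨l.1.1, (hall _ l.2).1⟩, l.2⟩,
        fun _ ↦ rfl, fun _ ↦ rfl⟩⟩

theorem exists_wordAvoids_equiv_count_eq [Fintype α] {p q p' q' : ℕ} (hp : 1 ≤ p) (hq : 1 ≤ q)
    (hp' : 1 ≤ p') (hq' : 1 ≤ q') (h : p + q = p' + q') :
    ∃ e : {l : List α // WordAvoids p q l} ≃ {l : List α // WordAvoids p' q' l},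
      ∀ l c, (e l).1.count c = l.1.count c := by
  refine ⟨Equiv.ofFiberEquiv (f := fun l : {l : List α // WordAvoids p q l} ↦ fun c ↦ l.1.count c)
    (g := fun l : {l : List α // WordAvoids p' q' l} ↦ fun c ↦ l.1.count c)
    fun s ↦ (nonempty_avoidingWord_equiv hp hq hp' hq' h s).some, fun l c ↦ ?_⟩
  exact congrFun (Equiv.ofFiberEquiv_map (f := fun l : {l : List α // WordAvoids p q l} ↦
    fun c ↦ l.1.count c) (g := fun l : {l : List α // WordAvoids p' q' l} ↦
    fun c ↦ l.1.count c) _ l) c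

end Words

section Colorings

variable {n r : ℕ}

theorem sameBlock_iff_part_eq {σ : Finpartition (Idx n)} {i j : ℕ} (hi : i ∈ Idx n)
    (hj : j ∈ Idx n) : SameBlock σ i j ↔ σ.part i = σ.part j := by
  rw [← σ.mem_part_iff_part_eq_part hi hj, σ.mem_part_iff_exists]
  rfl

theorem finpartition_ext_of_part {σ σ' : Finpartition (Idx n)}
    (h : ∀ i ∈ Idx n, ∀ j ∈ Idx n, σ.part i = σ.part j ↔ σ'.part i = σ'.part j) : σ = σ' := by
  have hpart : ∀ i ∈ Idx n, σ.part i = σ'.part i := by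
    intro i hi
    ext j
    by_cases hj : j ∈ Idx n
    · rw [σ.mem_part_iff_part_eq_part hj hi, σ'.mem_part_iff_part_eq_part hj hi, h j hj i hi]
    · exact ⟨fun hm ↦ (hj (σ.part_subset i hm)).elim, fun hm ↦ (hj (σ'.part_subset i hm)).elim⟩
  ext B
  constructor
  · intro hB
    obtain ⟨i, hi, rfl⟩ := σ.part_surjOn hB
    rw [hpart i hi]
    exact σ'.part_mem.2 hi
  · intro hB
    obtain ⟨i, hi, rfl⟩ := σ'.part_surjOn hB
    rw [← hpart i hi]
    exact σ.part_mem.2 hi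

theorem succ_mem_idx (i : Fin n) : (i : ℕ) + 1 ∈ Idx n := by
  simp [Idx]

/-- The word recording the labels of the blocks of `1, …, n`. -/
def blockWord (σ : Finpartition (Idx n)) (e : σ.parts ≃ Fin r) : List (Fin r) :=
  List.ofFn fun i : Fin n ↦ e ⟨σ.part (i + 1), σ.part_mem.2 (succ_mem_idx i)⟩

theorem length_blockWord (σ : Finpartition (Idx n)) (e : σ.parts ≃ Fin r) :
    (blockWord σ e).length = n := by
  simp [blockWord]

theorem getElem_blockWord (σ : Finpartition (Idx n)) (e : σ.parts ≃ Fin r) (i : ℕ)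
    (hi : i < (blockWord σ e).length) :
    (blockWord σ e)[i] = e ⟨σ.part (i + 1),
      σ.part_mem.2 (succ_mem_idx ⟨i, length_blockWord σ e ▸ hi⟩)⟩ := by
  simp [blockWord]

theorem getElem_blockWord_eq_iff (σ : Finpartition (Idx n)) (e : σ.parts ≃ Fin r) {i j : ℕ}
    (hi : i < (blockWord σ e).length) (hj : j < (blockWord σ e).length) :
    (blockWord σ e)[i] = (blockWord σ e)[j] ↔ σ.part (i + 1) = σ.part (j + 1) := by
  simp [getElem_blockWord]

theorem mem_blockWord (σ : Finpartition (Idx n)) (e : σ.parts ≃ Fin r) (c : Fin r) :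
    c ∈ blockWord σ e := by
  obtain ⟨i, hi, h⟩ := σ.part_surjOn (e.symm c).2
  have hi' : 1 ≤ i ∧ i ≤ n := by simpa [Idx] using hi
  rw [List.mem_iff_getElem]
  refine ⟨i - 1, by rw [length_blockWord]; omega, ?_⟩
  rw [getElem_blockWord, ← Equiv.eq_symm_apply]
  refine Subtype.ext ?_
  simp only [Nat.sub_add_cancel hi'.1, h]

theorem blockWord_bijective :
    Function.Bijective (fun x : (Σ σ : Finpartition (Idx n), σ.parts ≃ Fin r) ↦
      (⟨blockWord x.1 x.2, length_blockWord x.1 x.2, mem_blockWord x.1 x.2⟩ :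
        {l : List (Fin r) // l.length = n ∧ ∀ c, c ∈ l})) := by
  constructor
  · rintro ⟨σ, e⟩ ⟨σ', e'⟩ h
    have hw : blockWord σ e = blockWord σ' e' := congrArg Subtype.val h
    obtain rfl : σ = σ' := by
      refine finpartition_ext_of_part fun i hi j hj ↦ ?_
      have hi' : 1 ≤ i ∧ i ≤ n := by simpa [Idx] using hi
      have hj' : 1 ≤ j ∧ j ≤ n := by simpa [Idx] using hj
      have h₁ := getElem_blockWord_eq_iff σ e (i := i - 1) (j := j - 1)
        (by rw [length_blockWord]; omega) (by rw [length_blockWord]; omega)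
      have h₂ := getElem_blockWord_eq_iff σ' e' (i := i - 1) (j := j - 1)
        (by rw [length_blockWord]; omega) (by rw [length_blockWord]; omega)
      simp only [Nat.sub_add_cancel hi'.1, Nat.sub_add_cancel hj'.1] at h₁ h₂
      rw [← h₁, ← h₂]
      simp only [hw]
    congr 1
    ext ⟨B, hB⟩ : 1
    obtain ⟨i, hi, rfl⟩ := σ.part_surjOn hB
    have hi' : 1 ≤ i ∧ i ≤ n := by simpa [Idx] using hi
    have h₁ := getElem_blockWord σ e (i - 1) (by rw [length_blockWord]; omega)
    have h₂ := getElem_blockWord σ e' (i - 1) (by rw [length_blockWord]; omega)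
    simp only [Nat.sub_add_cancel hi'.1] at h₁ h₂
    rw [← h₁, ← h₂]
    simp only [hw]
  · rintro ⟨l, rfl, hl⟩
    classical
    let σ : Finpartition (Idx l.length) :=
      Finpartition.ofSetSetoid (Setoid.ker fun i ↦ l[i - 1]?) (Idx l.length)
    have hσ : ∀ i j (hi : i < l.length) (hj : j < l.length),
        σ.part (i + 1) = σ.part (j + 1) ↔ l[i] = l[j] := by
      intro i j hi hj
      have hi' := succ_mem_idx ⟨i, hi⟩
      have hj' := succ_mem_idx ⟨j, hj⟩
      rw [← σ.mem_part_iff_part_eq_part hi' hj', Finpartition.mem_part_ofSetSetoid_iff_rel]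
      simp only at hi' hj'
      simp [hi', hj', Setoid.ker_def, hi, hj, eq_comm]
    have hlt : ∀ c, l.idxOf c < l.length := fun c ↦ List.idxOf_lt_length_of_mem (hl c)
    let φ : Fin r → σ.parts := fun c ↦
      ⟨σ.part (l.idxOf c + 1), σ.part_mem.2 (succ_mem_idx ⟨_, hlt c⟩)⟩
    have hφ : Function.Bijective φ := by
      constructor
      · intro c d h
        have := (hσ _ _ (hlt c) (hlt d)).1 (congrArg Subtype.val h)
        simpa using this
      · rintro ⟨B, hB⟩
        obtain ⟨i, hi, rfl⟩ := σ.part_surjOn hB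
        have hi' : 1 ≤ i ∧ i ≤ l.length := by simpa [Idx] using hi
        refine ⟨l[i - 1], Subtype.ext ?_⟩
        have := (hσ _ (i - 1) (hlt l[i - 1]) (by omega)).2 (by simp)
        simpa only [Nat.sub_add_cancel hi'.1] using this
    refine ⟨⟨σ, (Equiv.ofBijective φ hφ).symm⟩, Subtype.ext ?_⟩
    refine List.ext_getElem (length_blockWord _ _) fun i h₁ h₂ ↦ ?_
    simp only [getElem_blockWord]
    rw [Equiv.symm_apply_eq]
    exact Subtype.ext ((hσ _ _ h₂ (hlt _)).2 (by simp))

end Colorings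

section Pattern

variable {n r p q : ℕ}

theorem sameBlock_beta_iff {k a : ℕ} {β : Finpartition (Idx k)}
    (hβ : β.parts = {{a}, Idx k \ {a}}) {i j : ℕ} (hi : i ∈ Idx k) (hj : j ∈ Idx k) :
    SameBlock β i j ↔ (i = a ↔ j = a) := by
  simp only [SameBlock, hβ, Finset.mem_insert, Finset.mem_singleton, exists_eq_or_imp,
    exists_eq_left, Finset.mem_sdiff, hi, hj, true_and]
  tauto

theorem getElem_replicate_append_cons_replicate {α : Type*} (c x : α) (i : ℕ)
    (hi : i < (List.replicate p c ++ x :: List.replicate q c).length) :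
    (List.replicate p c ++ x :: List.replicate q c)[i] = if i = p then x else c := by
  rw [List.getElem_append]
  split
  · rename_i h
    simp at h
    simp [h.ne]
  · rename_i h
    have h' : p ≤ i := by simpa using h
    simp only [List.getElem_cons, List.getElem_replicate, List.length_replicate]
    split <;> split <;> first | rfl | omega

theorem avoids_iff_wordAvoids (hp : 1 ≤ p) {β : Finpartition (Idx (p + 1 + q))}
    (hβ : β.parts = {{p + 1}, Idx (p + 1 + q) \ {p + 1}}) (σ : Finpartition (Idx n))
    (e : σ.parts ≃ Fin r) : Avoids σ β ↔ WordAvoids p q (blockWord σ e) := by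
  rw [Avoids, ← not_iff_comm, WordAvoids]
  push Not
  simp only [List.sublist_iff_exists_fin_orderEmbedding_get_eq, List.get_eq_getElem,
    getElem_replicate_append_cons_replicate]
  have hlen : ∀ c x : Fin r,
      (List.replicate p c ++ x :: List.replicate q c).length = p + 1 + q := by
    intro c x
    simp
    omega
  have hfin : ∀ (c x : Fin r)
      (i : Fin (List.replicate p c ++ x :: List.replicate q c).length), (i : ℕ) < p + 1 + q :=
    fun c x i ↦ i.2.trans_eq (hlen c x)
  constructor
  · rintro ⟨c, x, hx, g, hg⟩
    have hlt := fun i ↦ (g i).2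
    simp only [length_blockWord] at hlt
    refine ⟨fun i ↦ if h : i - 1 < (List.replicate p c ++ x :: List.replicate q c).length then
      g ⟨i - 1, h⟩ + 1 else 0, ?_, ?_, ?_⟩
    · intro i hi j hj hij
      simp only [Idx, Finset.coe_Icc, Set.mem_Icc] at hi hj
      have hi' := hlen c x ▸ (show i - 1 < p + 1 + q by omega)
      have hj' := hlen c x ▸ (show j - 1 < p + 1 + q by omega)
      simp only [hi', hj', dif_pos, add_lt_add_iff_right, Fin.val_fin_lt, OrderEmbedding.lt_iff_lt,
        Fin.mk_lt_mk]
      omega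
    · intro i hi
      simp only [Idx, Finset.mem_Icc] at hi
      have hi' := hlen c x ▸ (show i - 1 < p + 1 + q by omega)
      simp only [hi', dif_pos]
      exact succ_mem_idx ⟨_, hlt _⟩
    · intro i hi j hj
      rw [sameBlock_beta_iff hβ hi hj]
      simp only [Idx, Finset.mem_Icc] at hi hj
      have hi' := hlen c x ▸ (show i - 1 < p + 1 + q by omega)
      have hj' := hlen c x ▸ (show j - 1 < p + 1 + q by omega)
      simp only [hi', hj', dif_pos]
      rw [sameBlock_iff_part_eq (succ_mem_idx ⟨_, hlt _⟩) (succ_mem_idx ⟨_, hlt _⟩),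
        ← getElem_blockWord_eq_iff σ e (g _).2 (g _).2, ← hg, ← hg]
      have h₁ : i - 1 = p ↔ i = p + 1 := by omega
      have h₂ : j - 1 = p ↔ j = p + 1 := by omega
      simp only [h₁, h₂]
      split_ifs <;> simp_all [eq_comm]
  · rintro ⟨f, hmono, hmem, hf⟩
    have hmem' : ∀ i, i < p + 1 + q → 1 ≤ f (i + 1) ∧ f (i + 1) ≤ n := by
      intro i hi
      simpa [Idx] using hmem (i + 1) (succ_mem_idx ⟨i, hi⟩)
    have hpos : ∀ i, i < p + 1 + q → f (i + 1) - 1 < (blockWord σ e).length := by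
      intro i hi
      have := hmem' i hi
      rw [length_blockWord]
      omega
    have heq : ∀ i j (hi : i < p + 1 + q) (hj : j < p + 1 + q),
        (blockWord σ e)[f (i + 1) - 1]'(hpos i hi) = (blockWord σ e)[f (j + 1) - 1]'(hpos j hj) ↔
          (i = p ↔ j = p) := by
      intro i j hi hj
      have hi' : i + 1 ∈ Idx (p + 1 + q) := succ_mem_idx ⟨i, hi⟩
      have hj' : j + 1 ∈ Idx (p + 1 + q) := succ_mem_idx ⟨j, hj⟩
      rw [getElem_blockWord_eq_iff, Nat.sub_add_cancel (hmem' i hi).1,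
        Nat.sub_add_cancel (hmem' j hj).1, ← sameBlock_iff_part_eq (hmem _ hi') (hmem _ hj'),
        ← hf _ hi' _ hj', sameBlock_beta_iff hβ hi' hj']
      simp
    refine ⟨(blockWord σ e)[f (0 + 1) - 1]'(hpos 0 (by omega)),
      (blockWord σ e)[f (p + 1) - 1]'(hpos p (by omega)), ?_,
      OrderEmbedding.ofStrictMono (fun i ↦ ⟨f (i + 1) - 1, hpos i (hfin _ _ i)⟩) ?_, ?_⟩
    · rw [Ne, heq _ _ (by omega) (by omega)]
      omega
    · intro i j hij
      have hi : (i : ℕ) < p + 1 + q := hfin _ _ i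
      have hj : (j : ℕ) < p + 1 + q := hfin _ _ j
      have hlt : f (i + 1) < f (j + 1) := hmono (succ_mem_idx ⟨i, hi⟩) (succ_mem_idx ⟨j, hj⟩)
        (Nat.succ_lt_succ hij)
      have := hmem' i hi
      refine Fin.mk_lt_mk.2 ?_
      omega
    · intro i
      have hi : (i : ℕ) < p + 1 + q := hfin _ _ i
      change (if (i : ℕ) = p then _ else _) = (blockWord σ e)[f (i + 1) - 1]'(hpos i hi)
      split_ifs with h
      · rw [heq _ _ (by omega) hi]
        omega
      · rw [heq _ _ (by omega) hi]
        omega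

theorem card_avoids_mul_factorial (hp : 1 ≤ p) {β : Finpartition (Idx (p + 1 + q))}
    (hβ : β.parts = {{p + 1}, Idx (p + 1 + q) \ {p + 1}}) (n r : ℕ) :
    Nat.card {σ : {σ : Finpartition (Idx n) // Avoids σ β} // σ.1.parts.card = r} * r.factorial =
      Nat.card {l : {l : List (Fin r) // WordAvoids p q l} // l.1.length = n ∧ ∀ c, c ∈ l.1} := by
  let e₁ : {x : (Σ σ : Finpartition (Idx n), σ.parts ≃ Fin r) // Avoids x.1 β} ≃
      {l : {l : List (Fin r) // l.length = n ∧ ∀ c, c ∈ l} // WordAvoids p q l.1} :=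
    (Equiv.ofBijective _ blockWord_bijective).subtypeEquiv
      fun x ↦ avoids_iff_wordAvoids hp hβ x.1 x.2
  let e₂ : {l : {l : List (Fin r) // l.length = n ∧ ∀ c, c ∈ l} // WordAvoids p q l.1} ≃
      {l : {l : List (Fin r) // WordAvoids p q l} // l.1.length = n ∧ ∀ c, c ∈ l.1} :=
    { toFun l := ⟨⟨l.1.1, l.2⟩, l.1.2⟩
      invFun l := ⟨⟨l.1.1, l.2⟩, l.1.2⟩
      left_inv _ := rfl
      right_inv _ := rfl }
  let e₃ : {x : (Σ σ : Finpartition (Idx n), σ.parts ≃ Fin r) // Avoids x.1 β} ≃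
      Σ σ : {σ : {σ : Finpartition (Idx n) // Avoids σ β} // σ.1.parts.card = r},
        (σ.1.1.parts ≃ Fin r) :=
    { toFun x := ⟨⟨⟨x.1.1, x.2⟩, by simpa using Fintype.card_congr x.1.2⟩, x.1.2⟩
      invFun x := ⟨⟨x.1.1.1, x.2⟩, x.1.1.2⟩
      left_inv _ := rfl
      right_inv _ := rfl }
  rw [← Nat.card_congr (e₁.trans e₂), Nat.card_congr e₃]
  have := Fintype.ofFinite
    {σ : {σ : Finpartition (Idx n) // Avoids σ β} // σ.1.parts.card = r}
  rw [Nat.card_sigma, Finset.sum_congr rfl (g := fun _ ↦ r.factorial)]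
  · simp [Nat.card_eq_fintype_card]
  · intro σ _
    rw [Nat.card_eq_fintype_card,
      Fintype.card_equiv (Fintype.equivOfCardEq (by simpa using σ.2)), Fintype.card_coe, σ.2]

theorem avoidCount_eq_of_add_eq {p' q' : ℕ} (hp : 1 ≤ p) (hq : 1 ≤ q) (hp' : 1 ≤ p')
    (hq' : 1 ≤ q') (h : p + q = p' + q')
    {β : Finpartition (Idx (p + 1 + q))} {β' : Finpartition (Idx (p' + 1 + q'))}
    (hβ : β.parts = {{p + 1}, Idx (p + 1 + q) \ {p + 1}})
    (hβ' : β'.parts = {{p' + 1}, Idx (p' + 1 + q') \ {p' + 1}}) (n : ℕ) :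
    avoidCount n β = avoidCount n β' := by
  refine Nat.card_congr (Equiv.ofFiberEquiv (f := fun σ ↦ σ.1.parts.card)
    (g := fun σ ↦ σ.1.parts.card) fun r ↦ (Finite.card_eq.1 ?_).some)
  refine Nat.eq_of_mul_eq_mul_right r.factorial_pos ?_
  rw [card_avoids_mul_factorial hp hβ, card_avoids_mul_factorial hp' hβ']
  obtain ⟨e, he⟩ := exists_wordAvoids_equiv_count_eq (α := Fin r) hp hq hp' hq' h
  refine Nat.card_congr (e.subtypeEquiv fun l ↦ ?_)
  have hlen : (e l).1.length = l.1.length := by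
    rw [← Multiset.coe_card, ← Multiset.coe_card]
    congr 1
    ext c
    simpa using he l c
  simp only [hlen, ← List.count_pos_iff, he]

end Pattern

/-- For `2 ≤ a, b ≤ k - 1` the patterns `β_{k,a}` and `β_{k,b}` are Wilf-equivalent:
`|Π_n(β_{k,a})| = |Π_n(β_{k,b})|` for all `n > k`. -/
theorem avoidCount_beta_wilf_equiv (k a b : ℕ) (hk : 4 ≤ k)
    (ha : 2 ≤ a) (hak : a ≤ k - 1) (hb : 2 ≤ b) (hbk : b ≤ k - 1)
    (βa βb : Finpartition (Idx k))
    (hβa : βa.parts = {{a}, Idx k \ {a}})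
    (hβb : βb.parts = {{b}, Idx k \ {b}}) :
    ∀ n : ℕ, k < n → avoidCount n βa = avoidCount n βb := by
  obtain ⟨p, rfl⟩ : ∃ p, a = p + 1 := ⟨a - 1, by omega⟩
  obtain ⟨q, rfl⟩ : ∃ q, k = p + 1 + q := ⟨k - (p + 1), by omega⟩
  obtain ⟨p', rfl⟩ : ∃ p', b = p' + 1 := ⟨b - 1, by omega⟩
  obtain ⟨q', hq'⟩ : ∃ q', p + 1 + q = p' + 1 + q' := ⟨p + q - p', by omega⟩
  intro n _
  have transport : ∀ m (hm : p + 1 + q = m) (β : Finpartition (Idx (p + 1 + q))),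
      β.parts = {{p' + 1}, Idx (p + 1 + q) \ {p' + 1}} →
      ∃ β' : Finpartition (Idx m), β'.parts = {{p' + 1}, Idx m \ {p' + 1}} ∧
        avoidCount n β = avoidCount n β' := by
    rintro _ rfl β h
    exact ⟨β, h, rfl⟩
  obtain ⟨β', hβ', h⟩ := transport _ hq' βb hβb
  rw [h]
  exact avoidCount_eq_of_add_eq (by omega) (by omega) (by omega) (by omega) (by omega) hβa hβ' n
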